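/- arXiv:2202.05405 — 2 statements merged into one kernel-verified Lean document; each statement's English description precedes it below -/
import Mathlib

section
/- Let λ ∈ V be a dominant weight, w ∈ W, and μ ∈ V. Then μ ∈ P_λ^w if and only if for every index 1 ≤ i ≤ r and every v ∈ W^{P_i}, the inequality ⟨λ, u x_i⟩ ≤ ⟨μ, v x_i⟩ holds, where u is the minimal-length representative of the coset (w⁻¹ * v) W_{P_i}. -/
open scoped Classical

/-- Data of a root system with a fixed choice of simple roots: an ambient
`ℚ`-vector space `V`, a set of roots `Φ` with a distinguished subset `pos` of
positive roots, a coroot functional `coroot β = ⟨·, β^∨⟩` for each root, and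
simple roots `α 1, …, α r`. -/
structure RootData where
  r : ℕ
  V : Type
  [grp : AddCommGroup V]
  [mod : Module ℚ V]
  Φ : Set V
  pos : Set V
  coroot : V → Module.Dual ℚ V
  α : Fin r → V

attribute [instance] RootData.grp RootData.mod

namespace RootData

variable (R : RootData)

/-- The group of linear automorphisms of `V`, in which the Weyl group lives. -/
abbrev Aut : Type := R.V ≃ₗ[ℚ] R.V

/-- The linear map `v ↦ v - ⟨v, β^∨⟩ β`. -/
noncomputable def reflMap (β : R.V) : R.V →ₗ[ℚ] R.V :=
  LinearMap.id - (R.coroot β).smulRight β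

/-- The reflection `s_β` associated to a root `β`, as a linear automorphism. -/
noncomputable def s (β : R.V) : R.Aut :=
  if h : (R.reflMap β).comp (R.reflMap β) = LinearMap.id then
    LinearEquiv.ofLinear (R.reflMap β) (R.reflMap β) h h
  else LinearEquiv.refl ℚ R.V

/-- The simple reflections `s_i := s_{α_i}`. -/
noncomputable def S (i : Fin R.r) : R.Aut := R.s (R.α i)

/-- The Weyl group `W`, generated by the simple reflections. -/
noncomputable def weylGroup : Subgroup R.Aut := Subgroup.closure (Set.range R.S)

/-- The product `s_{i_1} ⋯ s_{i_k}` of a word in the simple reflections. -/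
noncomputable def wordProd (l : List (Fin R.r)) : R.Aut := (l.map R.S).prod

/-- The length function on `W`: least length of a word in the simple
reflections expressing the given element. -/
noncomputable def len (w : R.Aut) : ℕ :=
  sInf {n | ∃ l : List (Fin R.r), l.length = n ∧ R.wordProd l = w}

/-- A word is reduced if its length equals the length of its product. -/
def Reduced (l : List (Fin R.r)) : Prop := R.len (R.wordProd l) = l.length

/-- The Bruhat order on `W`: `u ≤ w` iff some reduced word for `w` has a
subword whose product is `u`. -/
def BruhatLE (u w : R.Aut) : Prop :=
  ∃ l : List (Fin R.r), R.Reduced l ∧ R.wordProd l = w ∧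
    ∃ l' : List (Fin R.r), l'.Sublist l ∧ R.wordProd l' = u

/-- Strict Bruhat order. -/
def BruhatLT (u w : R.Aut) : Prop := R.BruhatLE u w ∧ u ≠ w

/-- One step of the Demazure product: `s_i * w := max {w, s_i w}`. -/
noncomputable def dmulStep (i : Fin R.r) (x : R.Aut) : R.Aut :=
  if R.len x < R.len (R.S i * x) then R.S i * x else x

/-- Demazure product of a word in the simple reflections against `w`:
`s_{i_1} * (s_{i_2} * (⋯ * (s_{i_k} * w)))`. -/
noncomputable def dmulList (l : List (Fin R.r)) (w : R.Aut) : R.Aut :=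
  l.foldr R.dmulStep w

/-- The Demazure product `v * w` on the Weyl group, computed by choosing a
reduced word for `v` (it is independent of this choice). -/
noncomputable def dmul (v w : R.Aut) : R.Aut :=
  if h : ∃ l : List (Fin R.r), R.Reduced l ∧ R.wordProd l = v then
    R.dmulList h.choose w
  else v * w

/-- The parabolic subgroup `W_{P_i}` generated by the simple reflections
`s_j`, `j ≠ i`. -/
noncomputable def WPar (i : Fin R.r) : Subgroup R.Aut :=
  Subgroup.closure (R.S '' {j | j ≠ i})

/-- `W^{P_i}`: the set of minimal-length representatives of cosets of
`W/W_{P_i}`. -/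
def minReps (i : Fin R.r) : Set R.Aut :=
  {v | v ∈ R.weylGroup ∧ ∀ p ∈ R.WPar i, R.len v ≤ R.len (v * p)}

/-- `u` is the minimal-length representative of the coset `w W_{P_i}`. -/
def IsMinRep (i : Fin R.r) (u w : R.Aut) : Prop :=
  u ∈ R.minReps i ∧ u⁻¹ * w ∈ R.WPar i

/-- A weight is dominant if it pairs nonnegatively with every simple coroot. -/
def Dominant (lam : R.V) : Prop := ∀ i : Fin R.r, 0 ≤ R.coroot (R.α i) lam

/-- The dual action of the Weyl group on `V* `: `(u f)(v) = f(u⁻¹ v)`. -/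
noncomputable def dualAct (u : R.Aut) (f : Module.Dual ℚ R.V) : Module.Dual ℚ R.V :=
  f.comp (u.symm : R.V →ₗ[ℚ] R.V)

/-- The Demazure polytope `P_λ^w := conv {uλ : u ∈ W, u ≤ w}`. -/
noncomputable def demPolytope (lam : R.V) (w : R.Aut) : Set R.V :=
  convexHull ℚ {m | ∃ u : R.Aut, u ∈ R.weylGroup ∧ R.BruhatLE u w ∧ m = u lam}

/-- Membership in the weight lattice `X`. -/
def IsWeight (lam : R.V) : Prop := ∀ β ∈ R.Φ, ∃ m : ℤ, R.coroot β lam = (m : ℚ)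

/-- The root lattice `Q = ℤΦ`. -/
noncomputable def rootLattice : AddSubgroup R.V := AddSubgroup.closure R.Φ

/-- `w₀` is the longest element of the Weyl group. -/
def IsLongest (w₀ : R.Aut) : Prop :=
  w₀ ∈ R.weylGroup ∧ ∀ g ∈ R.weylGroup, R.len g ≤ R.len w₀

/-- The positive roots `Φ_{P_i}⁺ = Φ⁺ ∩ span {α_j : j ≠ i}` of the standard
Levi subsystem. -/
def parPos (i : Fin R.r) : Set R.V :=
  {η | η ∈ R.pos ∧ η ∈ Submodule.span ℚ (R.α '' {j | j ≠ i})}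

/-- The value `D_i (e^λ)` of the Demazure operator on a basis element of the
group ring `ℤ[X]`. -/
noncomputable def demOnBasis (i : Fin R.r) (lam : R.V) : R.V →₀ ℤ :=
  if 0 ≤ ⌊R.coroot (R.α i) lam⌋ then
    ∑ k ∈ Finset.range (⌊R.coroot (R.α i) lam⌋.toNat + 1),
      Finsupp.single (lam - (k : ℚ) • R.α i) 1
  else if ⌊R.coroot (R.α i) lam⌋ = -1 then 0
  else - ∑ k ∈ Finset.range ((-⌊R.coroot (R.α i) lam⌋).toNat - 1),
      Finsupp.single (lam + ((k : ℚ) + 1) • R.α i) 1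

/-- The Demazure operator `D_i`, as a `ℤ`-linear endomorphism of the group
ring `ℤ[X]` (realized as finitely supported functions `V →₀ ℤ`). -/
noncomputable def demOp (i : Fin R.r) : (R.V →₀ ℤ) →ₗ[ℤ] (R.V →₀ ℤ) :=
  Finsupp.lsum ℤ fun lam => LinearMap.toSpanSingleton ℤ (R.V →₀ ℤ) (R.demOnBasis i lam)

/-- The Demazure character `D_{i_1} ⋯ D_{i_k} (e^λ)`. -/
noncomputable def demChar (l : List (Fin R.r)) (lam : R.V) : R.V →₀ ℤ :=
  l.foldr (fun i p => R.demOp i p) (Finsupp.single lam 1)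

/-- The axioms of a finite crystallographic root system spanning `V`, with
simple roots `α_i` and positive roots `pos`. -/
structure IsRootSystem (R : RootData) : Prop where
  finite : R.Φ.Finite
  span_top : Submodule.span ℚ R.Φ = ⊤
  ne_zero : ∀ β ∈ R.Φ, β ≠ 0
  coroot_self : ∀ β ∈ R.Φ, R.coroot β β = 2
  crystallographic : ∀ β ∈ R.Φ, ∀ γ ∈ R.Φ, ∃ m : ℤ, R.coroot β γ = (m : ℚ)
  reflection_stable : ∀ β ∈ R.Φ, ∀ γ ∈ R.Φ, γ - R.coroot β γ • β ∈ R.Φ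
  simple_mem : ∀ i, R.α i ∈ R.Φ
  indep : LinearIndependent ℚ R.α
  pos_subset : R.pos ⊆ R.Φ
  pos_or_neg : ∀ β ∈ R.Φ, (β ∈ R.pos ∧ -β ∉ R.pos) ∨ (β ∉ R.pos ∧ -β ∈ R.pos)
  simple_pos : ∀ i, R.α i ∈ R.pos
  pos_nonneg_comb : ∀ β ∈ R.pos, ∃ c : Fin R.r → ℚ, (∀ i, 0 ≤ c i) ∧ β = ∑ i, c i • R.α i

end RootData

/-- Farkas' lemma for finitely many vectors in a rational vector space. -/
theorem exists_nonneg_comb_or_separating {V : Type*} [AddCommGroup V] [Module ℚ V] (n : ℕ) :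
    ∀ (a : Fin n → V) (b : V),
      (∃ c : Fin n → ℚ, (∀ i, 0 ≤ c i) ∧ b = ∑ i, c i • a i) ∨
        ∃ f : Module.Dual ℚ V, (∀ i, 0 ≤ f (a i)) ∧ f b < 0 := by
  induction n with
  | zero =>
    intro a b
    by_cases hb : b = 0
    · exact Or.inl ⟨0, by simp, by simp [hb]⟩
    · right
      obtain ⟨f, hf⟩ := Module.Projective.exists_dual_ne_zero ℚ hb
      rcases lt_or_gt_of_ne hf with h | h
      · exact ⟨f, fun i => i.elim0, h⟩
      · exact ⟨-f, fun i => i.elim0, by simpa using h⟩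
  | succ n ih =>
    intro a b
    rcases ih (fun i => a i.succ) b with ⟨c, hc, hb⟩ | ⟨f, hf, hfb⟩
    · refine Or.inl ⟨Fin.cons 0 c, fun i => ?_, ?_⟩
      · refine Fin.cases ?_ (fun j => ?_) i <;> simp [hc]
      · simpa [Fin.sum_univ_succ] using hb
    by_cases ha : 0 ≤ f (a 0)
    · exact Or.inr ⟨f, fun i => Fin.cases ha hf i, hfb⟩
    have ha' : f (a 0) < 0 := not_le.mp ha
    -- `π` is the projection along `a 0` onto the kernel of `f`
    let π : V →ₗ[ℚ] V := LinearMap.id - ((f (a 0))⁻¹ • f).smulRight (a 0)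
    have hπ : ∀ y, π y = y - ((f (a 0))⁻¹ * f y) • a 0 := fun y => by simp [π]
    rcases ih (fun i => π (a i.succ)) (π b) with ⟨c, hc, hb⟩ | ⟨g, hg, hgb⟩
    · left
      refine ⟨Fin.cons ((f (a 0))⁻¹ * f b - ∑ i, c i * ((f (a 0))⁻¹ * f (a i.succ))) c,
        fun i => ?_, ?_⟩
      · refine Fin.cases ?_ (fun j => ?_) i
        · have h1 : 0 ≤ (f (a 0))⁻¹ * f b :=
            mul_nonneg_of_nonpos_of_nonpos (inv_nonpos.mpr ha'.le) hfb.le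
          have h2 : ∑ i, c i * ((f (a 0))⁻¹ * f (a i.succ)) ≤ 0 :=
            Finset.sum_nonpos fun i _ => mul_nonpos_of_nonneg_of_nonpos (hc i)
              (mul_nonpos_of_nonpos_of_nonneg (inv_nonpos.mpr ha'.le) (hf i))
          simp only [Fin.cons_zero]
          linarith
        · simpa using hc j
      · simp only [hπ, smul_sub, Finset.sum_sub_distrib, smul_smul, ← Finset.sum_smul] at hb
        simp only [Fin.sum_univ_succ, Fin.cons_zero, Fin.cons_succ, sub_smul]
        rw [sub_eq_iff_eq_add] at hb
        refine hb.trans ?_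
        abel
    · refine Or.inr ⟨g.comp π, fun i => ?_, hgb⟩
      refine Fin.cases ?_ hg i
      simp [hπ, inv_mul_cancel₀ ha'.ne]

/-- A point outside the convex hull of a finite set in a rational vector space is strictly
separated from that set by a linear functional. -/
theorem exists_dual_lt_of_notMem_convexHull {V : Type*} [AddCommGroup V] [Module ℚ V]
    {F : Set V} (hF : F.Finite) {m : V} (hm : m ∉ convexHull ℚ F) :
    ∃ f : Module.Dual ℚ V, ∀ y ∈ F, f m < f y := by
  obtain ⟨n, a, rfl⟩ : ∃ (n : ℕ) (a : Fin n → V), Set.range a = F := by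
    obtain ⟨n, a, -, ha⟩ := hF.fin_param
    exact ⟨n, a, ha⟩
  rcases exists_nonneg_comb_or_separating n (fun i => (a i, (1 : ℚ))) (m, 1) with
    ⟨c, hc, h⟩ | ⟨f, hf, hfm⟩
  · refine absurd ?_ hm
    have h1 : m = ∑ i, c i • a i := by simpa [Prod.fst_sum] using congrArg Prod.fst h
    have h2 : 1 = ∑ i, c i := by simpa [Prod.snd_sum] using congrArg Prod.snd h
    rw [h1]
    exact (convex_convexHull ℚ _).sum_mem (fun i _ => hc i) h2.symm
      fun i _ => subset_convexHull ℚ _ ⟨i, rfl⟩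
  · refine ⟨f.comp (LinearMap.inl ℚ V ℚ), ?_⟩
    rintro _ ⟨i, rfl⟩
    have key : ∀ y : V, f (y, 1) = f (y, 0) + f (0, 1) := fun y => by
      rw [← map_add]; simp
    have h1 := hf i
    rw [key] at h1 hfm
    simp only [LinearMap.comp_apply, LinearMap.inl_apply]
    linarith

namespace RootData

variable {R : RootData}

theorem s_apply (hR : R.IsRootSystem) {β : R.V} (hβ : β ∈ R.Φ) (y : R.V) :
    R.s β y = y - R.coroot β y • β := by
  have h : (R.reflMap β).comp (R.reflMap β) = LinearMap.id := by
    ext y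
    simp [reflMap, hR.coroot_self β hβ, sub_smul, mul_smul]
    module
  rw [s, dif_pos h]
  simp [reflMap]

theorem S_apply (hR : R.IsRootSystem) (i : Fin R.r) (y : R.V) :
    R.S i y = y - R.coroot (R.α i) y • R.α i :=
  s_apply hR (hR.simple_mem i) y

theorem s_mul_self (hR : R.IsRootSystem) {β : R.V} (hβ : β ∈ R.Φ) : R.s β * R.s β = 1 := by
  ext y
  simp [s_apply hR hβ, hR.coroot_self β hβ, sub_smul, mul_smul]
  module

theorem S_mul_self (hR : R.IsRootSystem) (i : Fin R.r) : R.S i * R.S i = 1 :=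
  s_mul_self hR (hR.simple_mem i)

theorem S_mul_cancel (hR : R.IsRootSystem) (i : Fin R.r) (a : R.Aut) :
    R.S i * (R.S i * a) = a := by
  rw [← mul_assoc, S_mul_self hR, one_mul]

theorem S_inv (hR : R.IsRootSystem) (i : Fin R.r) : (R.S i)⁻¹ = R.S i :=
  inv_eq_of_mul_eq_one_left (S_mul_self hR i)

theorem s_self (hR : R.IsRootSystem) {β : R.V} (hβ : β ∈ R.Φ) : R.s β β = -β := by
  rw [s_apply hR hβ, hR.coroot_self β hβ]
  module

/-- The group of linear automorphisms preserving the set of roots. -/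
def rootAut (R : RootData) : Subgroup R.Aut where
  carrier := {a | ∀ y, a y ∈ R.Φ ↔ y ∈ R.Φ}
  mul_mem' {a b} ha hb y := (ha (b y)).trans (hb y)
  one_mem' y := Iff.rfl
  inv_mem' {a} ha y := by
    have := ha (a⁻¹ y)
    rw [← LinearEquiv.mul_apply, mul_inv_cancel] at this
    exact this.symm

theorem s_mem_rootAut (hR : R.IsRootSystem) {β : R.V} (hβ : β ∈ R.Φ) : R.s β ∈ R.rootAut := by
  have h : ∀ y ∈ R.Φ, R.s β y ∈ R.Φ := fun y hy => by
    rw [s_apply hR hβ]; exact hR.reflection_stable β hβ y hy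
  refine fun y => ⟨fun hy => ?_, h y⟩
  have := h _ hy
  rwa [← LinearEquiv.mul_apply, s_mul_self hR hβ] at this

theorem S_mem_rootAut (hR : R.IsRootSystem) (i : Fin R.r) : R.S i ∈ R.rootAut :=
  s_mem_rootAut hR (hR.simple_mem i)

theorem weylGroup_le_rootAut (hR : R.IsRootSystem) : R.weylGroup ≤ R.rootAut := by
  rw [weylGroup, Subgroup.closure_le]
  rintro _ ⟨i, rfl⟩
  exact S_mem_rootAut hR i

theorem S_mem_weylGroup (i : Fin R.r) : R.S i ∈ R.weylGroup :=
  Subgroup.subset_closure ⟨i, rfl⟩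

/-- Coroots are equivariant, and scale inversely to roots. -/
theorem smul_coroot_comp_inv (hR : R.IsRootSystem) {a : R.Aut} (ha : a ∈ R.rootAut)
    {β γ : R.V} (hβ : β ∈ R.Φ) (hγ : γ ∈ R.Φ) {c : ℚ} (h : a β = c • γ) (y : R.V) :
    c * R.coroot β (a⁻¹ y) = R.coroot γ y := by
  have hc : c ≠ 0 := by
    rintro rfl
    exact hR.ne_zero _ ((ha β).2 hβ) (by rw [h, zero_smul])
  have hinv : a⁻¹ γ = c⁻¹ • β := by
    have : γ = a (c⁻¹ • β) := by rw [map_smul, h, inv_smul_smul₀ hc]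
    rw [this, ← LinearEquiv.mul_apply, inv_mul_cancel]
    rfl
  have key : c • (R.coroot β).comp ((a⁻¹ : R.Aut) : R.V →ₗ[ℚ] R.V) = R.coroot γ := by
    refine Module.Dual.eq_of_preReflection_mapsTo (x := γ) hR.finite hR.span_top ?_ ?_
      (hR.coroot_self γ hγ) ?_
    · change c * R.coroot β (a⁻¹ γ) = 2
      rw [hinv, map_smul, hR.coroot_self β hβ, smul_eq_mul, mul_inv_cancel_left₀ hc]
    · intro y hy
      have h1 : a (R.s β (a⁻¹ y)) ∈ R.Φ :=
        (ha _).2 ((s_mem_rootAut hR hβ _).2 ((R.rootAut.inv_mem ha y).2 hy))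
      convert h1 using 1
      rw [s_apply hR hβ, map_sub, map_smul, h, ← LinearEquiv.mul_apply a, mul_inv_cancel]
      simp [Module.preReflection_apply, smul_smul, mul_comm]
    · intro y hy
      simpa [Module.preReflection_apply] using hR.reflection_stable γ hγ y hy
  have := LinearMap.congr_fun key y
  simpa using this

theorem mul_s_eq (hR : R.IsRootSystem) {a : R.Aut} (ha : a ∈ R.rootAut)
    {β γ : R.V} (hβ : β ∈ R.Φ) (hγ : γ ∈ R.Φ) {c : ℚ} (h : a β = c • γ) :
    a * R.s β = R.s γ * a := by
  ext y
  have := smul_coroot_comp_inv hR ha hβ hγ h (a y)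
  rw [← LinearEquiv.mul_apply, inv_mul_cancel] at this
  rw [LinearEquiv.mul_apply, LinearEquiv.mul_apply, s_apply hR hβ, s_apply hR hγ, map_sub,
    map_smul, h, ← this, smul_smul, mul_comm]
  rfl

/-- The functionals `x j` are the coordinates with respect to the simple roots. -/
theorem eq_sum_coweight (hR : R.IsRootSystem) {x : Fin R.r → Module.Dual ℚ R.V}
    (hx : ∀ i j : Fin R.r, x j (R.α i) = if i = j then 1 else 0) (y : R.V) :
    y = ∑ j, x j y • R.α j := by
  have hcomb : ∀ c : Fin R.r → ℚ,
      ∑ i, c i • R.α i = ∑ j, x j (∑ i, c i • R.α i) • R.α j := fun c => by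
    simp [hx]
  have hy : y ∈ Submodule.span ℚ R.Φ := by rw [hR.span_top]; trivial
  induction hy using Submodule.span_induction with
  | mem β hβ =>
    rcases hR.pos_or_neg β hβ with h | h
    · obtain ⟨c, -, rfl⟩ := hR.pos_nonneg_comb β h.1
      exact hcomb c
    · obtain ⟨c, -, hc⟩ := hR.pos_nonneg_comb (-β) h.2
      have := hcomb c
      rw [← hc] at this
      simpa using this
  | zero => simp
  | add y z _ _ hy hz =>
    simp only [map_add, add_smul, Finset.sum_add_distrib]
    rw [← hy, ← hz]
  | smul t y _ hy =>
    simp only [map_smul, smul_eq_mul, mul_smul, ← Finset.smul_sum]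
    rw [← hy]

theorem coweight_nonneg (hR : R.IsRootSystem) {x : Fin R.r → Module.Dual ℚ R.V}
    (hx : ∀ i j : Fin R.r, x j (R.α i) = if i = j then 1 else 0) {β : R.V}
    (hβ : β ∈ R.pos) (j : Fin R.r) : 0 ≤ x j β := by
  obtain ⟨c, hc, rfl⟩ := hR.pos_nonneg_comb β hβ
  simpa [hx] using hc j

theorem mem_pos_of_notMem (hR : R.IsRootSystem) {β : R.V} (hβ : β ∈ R.Φ) (h : β ∉ R.pos) :
    -β ∈ R.pos := by
  rcases hR.pos_or_neg β hβ with h' | h'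
  · exact absurd h'.1 h
  · exact h'.2

theorem neg_notMem_pos (hR : R.IsRootSystem) {β : R.V} (h : β ∈ R.pos) : -β ∉ R.pos := by
  rcases hR.pos_or_neg β (hR.pos_subset h) with h' | h'
  · exact h'.2
  · exact absurd h h'.1

/-- A positive root made negative by `s_i` is proportional to `α_i`. -/
theorem eq_smul_of_S_notMem_pos (hR : R.IsRootSystem) {x : Fin R.r → Module.Dual ℚ R.V}
    (hx : ∀ i j : Fin R.r, x j (R.α i) = if i = j then 1 else 0) {i : Fin R.r} {γ : R.V}
    (hγ : γ ∈ R.pos) (h : R.S i γ ∉ R.pos) : γ = x i γ • R.α i := by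
  have hneg := mem_pos_of_notMem hR ((S_mem_rootAut hR i γ).2 (hR.pos_subset hγ)) h
  have hzero : ∀ j, j ≠ i → x j γ = 0 := fun j hj => by
    have h1 := coweight_nonneg hR hx hγ j
    have h2 := coweight_nonneg hR hx hneg j
    rw [S_apply hR] at h2
    simp only [map_neg, map_sub, map_smul, hx, if_neg hj.symm, smul_zero, sub_zero] at h2
    linarith
  conv_lhs => rw [eq_sum_coweight hR hx γ]
  exact Finset.sum_eq_single i (fun j _ hj => by rw [hzero j hj, zero_smul]) (by simp)

@[simp]
theorem wordProd_nil : R.wordProd [] = 1 := rfl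

@[simp]
theorem wordProd_cons (i : Fin R.r) (l : List (Fin R.r)) :
    R.wordProd (i :: l) = R.S i * R.wordProd l := by simp [wordProd]

theorem wordProd_append (l m : List (Fin R.r)) :
    R.wordProd (l ++ m) = R.wordProd l * R.wordProd m := by simp [wordProd]

theorem wordProd_mem (l : List (Fin R.r)) : R.wordProd l ∈ R.weylGroup := by
  induction l with
  | nil => exact R.weylGroup.one_mem
  | cons i l ih => rw [wordProd_cons]; exact R.weylGroup.mul_mem (S_mem_weylGroup i) ih

theorem wordProd_reverse (hR : R.IsRootSystem) (l : List (Fin R.r)) :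
    R.wordProd l.reverse = (R.wordProd l)⁻¹ := by
  induction l with
  | nil => simp
  | cons i l ih => simp [wordProd_append, ih, S_inv hR]

theorem exists_wordProd_eq (hR : R.IsRootSystem) {a : R.Aut} (ha : a ∈ R.weylGroup) :
    ∃ l, R.wordProd l = a := by
  induction ha using Subgroup.closure_induction with
  | mem a ha => obtain ⟨i, rfl⟩ := ha; exact ⟨[i], by simp⟩
  | one => exact ⟨[], rfl⟩
  | mul a b _ _ ha hb =>
    obtain ⟨l, rfl⟩ := ha
    obtain ⟨m, rfl⟩ := hb
    exact ⟨l ++ m, wordProd_append l m⟩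
  | inv a _ ha =>
    obtain ⟨l, rfl⟩ := ha
    exact ⟨l.reverse, wordProd_reverse hR l⟩

theorem len_wordProd_le (l : List (Fin R.r)) : R.len (R.wordProd l) ≤ l.length :=
  Nat.sInf_le ⟨l, rfl, rfl⟩

theorem exists_reduced (hR : R.IsRootSystem) {a : R.Aut} (ha : a ∈ R.weylGroup) :
    ∃ l, R.Reduced l ∧ R.wordProd l = a := by
  obtain ⟨l, hl⟩ := exists_wordProd_eq hR ha
  obtain ⟨m, hm, rfl⟩ := Nat.sInf_mem
    (⟨l.length, l, rfl, hl⟩ : {n | ∃ l, l.length = n ∧ R.wordProd l = a}.Nonempty)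
  exact ⟨m, hm.symm, rfl⟩

theorem len_inv (hR : R.IsRootSystem) {a : R.Aut} (ha : a ∈ R.weylGroup) :
    R.len a⁻¹ = R.len a := by
  have h : ∀ b ∈ R.weylGroup, R.len b⁻¹ ≤ R.len b := fun b hb => by
    obtain ⟨l, hl, rfl⟩ := exists_reduced hR hb
    rw [← wordProd_reverse hR, hl]
    simpa using len_wordProd_le l.reverse
  refine le_antisymm (h a ha) ?_
  simpa using h a⁻¹ (R.weylGroup.inv_mem ha)

/-- The strong exchange property, for words which need not be reduced. -/
theorem strong_exchange (hR : R.IsRootSystem) {x : Fin R.r → Module.Dual ℚ R.V}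
    (hx : ∀ i j : Fin R.r, x j (R.α i) = if i = j then 1 else 0) {β : R.V}
    (hβ : β ∈ R.pos) (l : List (Fin R.r)) (h : R.wordProd l β ∉ R.pos) :
    ∃ m : List (Fin R.r), m.Sublist l ∧ m.length < l.length ∧
      R.wordProd m = R.wordProd l * R.s β := by
  induction l with
  | nil => exact absurd hβ h
  | cons i l ih =>
    by_cases hl : R.wordProd l β ∈ R.pos
    · refine ⟨l, List.sublist_cons_self i l, by simp, ?_⟩
      rw [wordProd_cons] at h
      have hc := eq_smul_of_S_notMem_pos hR hx hl h
      rw [wordProd_cons, mul_assoc, mul_s_eq hR (weylGroup_le_rootAut hR (wordProd_mem l))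
        (hR.pos_subset hβ) (hR.simple_mem i) hc]
      exact (S_mul_cancel hR i _).symm
    · obtain ⟨m, hm, hlen, hprod⟩ := ih hl
      exact ⟨i :: m, hm.cons_cons i, by simpa using hlen, by simp [hprod, mul_assoc]⟩

theorem len_S_mul_lt (hR : R.IsRootSystem) {x : Fin R.r → Module.Dual ℚ R.V}
    (hx : ∀ i j : Fin R.r, x j (R.α i) = if i = j then 1 else 0) {a : R.Aut}
    (ha : a ∈ R.weylGroup) {i : Fin R.r} (h : a⁻¹ (R.α i) ∉ R.pos) :
    R.len (R.S i * a) < R.len a := by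
  obtain ⟨l, hl, hla⟩ := exists_reduced hR (R.weylGroup.inv_mem ha)
  rw [← hla] at h
  obtain ⟨m, -, hlen, hprod⟩ := strong_exchange hR hx (hR.simple_pos i) l h
  have hm : R.wordProd m = (R.S i * a)⁻¹ := by
    rw [hprod, hla, mul_inv_rev, S_inv hR]; rfl
  rw [← len_inv hR (R.weylGroup.mul_mem (S_mem_weylGroup i) ha), ← len_inv hR ha, ← hm, ← hla, hl]
  exact (len_wordProd_le m).trans_lt hlen

theorem len_lt_len_S_mul_iff (hR : R.IsRootSystem) {x : Fin R.r → Module.Dual ℚ R.V}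
    (hx : ∀ i j : Fin R.r, x j (R.α i) = if i = j then 1 else 0) {a : R.Aut}
    (ha : a ∈ R.weylGroup) (i : Fin R.r) :
    R.len a < R.len (R.S i * a) ↔ a⁻¹ (R.α i) ∈ R.pos := by
  constructor
  · intro h
    by_contra h'
    exact absurd (len_S_mul_lt hR hx ha h') h.not_gt
  · intro h
    have h1 := len_S_mul_lt hR hx (R.weylGroup.mul_mem (S_mem_weylGroup i) ha) (i := i) (by
      rw [mul_inv_rev, S_inv hR, LinearEquiv.mul_apply, S, s_self hR (hR.simple_mem i), map_neg]
      exact neg_notMem_pos hR h)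
    rwa [S_mul_cancel hR] at h1

/-- One step up in the Bruhat order, by multiplication with a reflection. -/
def ReflStep (a b : R.Aut) : Prop :=
  a ∈ R.rootAut ∧ ∃ β ∈ R.pos, a β ∈ R.pos ∧ b = a * R.s β

/-- The Bruhat order described by chains of reflections. -/
def ChainLE : R.Aut → R.Aut → Prop := Relation.ReflTransGen ReflStep

theorem dmulStep_mem {a : R.Aut} (ha : a ∈ R.weylGroup) (i : Fin R.r) :
    R.dmulStep i a ∈ R.weylGroup := by
  unfold dmulStep
  split_ifs
  · exact R.weylGroup.mul_mem (S_mem_weylGroup i) ha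
  · exact ha

theorem dmulList_mem {a : R.Aut} (ha : a ∈ R.weylGroup) (l : List (Fin R.r)) :
    R.dmulList l a ∈ R.weylGroup := by
  induction l with
  | nil => exact ha
  | cons i l ih => exact dmulStep_mem ih i

theorem chainLE_dmulStep (hR : R.IsRootSystem) {x : Fin R.r → Module.Dual ℚ R.V}
    (hx : ∀ i j : Fin R.r, x j (R.α i) = if i = j then 1 else 0) {a : R.Aut}
    (ha : a ∈ R.weylGroup) (i : Fin R.r) : ChainLE a (R.dmulStep i a) := by
  unfold dmulStep
  split_ifs with h
  · rw [len_lt_len_S_mul_iff hR hx ha] at h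
    have hα : a (a⁻¹ (R.α i)) = R.α i := by
      rw [← LinearEquiv.mul_apply, mul_inv_cancel]; rfl
    refine Relation.ReflTransGen.single
      ⟨weylGroup_le_rootAut hR ha, _, h, by rw [hα]; exact hR.simple_pos i, ?_⟩
    exact (mul_s_eq hR (weylGroup_le_rootAut hR ha) (hR.pos_subset h) (hR.simple_mem i)
      (c := 1) (by rw [hα, one_smul])).symm
  · exact Relation.ReflTransGen.refl

theorem S_mul_chainLE_dmulStep_self (hR : R.IsRootSystem) {x : Fin R.r → Module.Dual ℚ R.V}
    (hx : ∀ i j : Fin R.r, x j (R.α i) = if i = j then 1 else 0) {a : R.Aut}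
    (ha : a ∈ R.weylGroup) (i : Fin R.r) : ChainLE (R.S i * a) (R.dmulStep i a) := by
  unfold dmulStep
  split_ifs with h
  · exact Relation.ReflTransGen.refl
  · rw [len_lt_len_S_mul_iff hR hx ha] at h
    have haΦ := weylGroup_le_rootAut hR ha
    have hβ := mem_pos_of_notMem hR ((R.rootAut.inv_mem haΦ _).2 (hR.simple_mem i)) h
    have hα : a (-a⁻¹ (R.α i)) = -R.α i := by
      rw [map_neg, ← LinearEquiv.mul_apply, mul_inv_cancel]; rfl
    refine Relation.ReflTransGen.single
      ⟨R.rootAut.mul_mem (S_mem_rootAut hR i) haΦ, _, hβ, ?_, ?_⟩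
    · rw [LinearEquiv.mul_apply, hα, map_neg, S, s_self hR (hR.simple_mem i), neg_neg]
      exact hR.simple_pos i
    · rw [mul_assoc, mul_s_eq hR haΦ (hR.pos_subset hβ) (hR.simple_mem i) (c := -1)
        (by rw [hα, neg_one_smul])]
      exact (S_mul_cancel hR i a).symm

/-- The lifting property of the Bruhat order. -/
theorem S_mul_chainLE_dmulStep (hR : R.IsRootSystem) {x : Fin R.r → Module.Dual ℚ R.V}
    (hx : ∀ i j : Fin R.r, x j (R.α i) = if i = j then 1 else 0) {a b : R.Aut}
    (hb : b ∈ R.weylGroup) (hab : ChainLE a b) (i : Fin R.r) :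
    ChainLE (R.S i * a) (R.dmulStep i b) := by
  induction hab using Relation.ReflTransGen.head_induction_on with
  | refl => exact S_mul_chainLE_dmulStep_self hR hx hb i
  | head hstep hle ih =>
    rename_i a c
    obtain ⟨ha, β, hβ, haβ, rfl⟩ := hstep
    by_cases h : R.S i (a β) ∈ R.pos
    · exact Relation.ReflTransGen.head
        ⟨R.rootAut.mul_mem (S_mem_rootAut hR i) ha, β, hβ, h, (mul_assoc _ _ _).symm⟩ ih
    · have := mul_s_eq hR ha (hR.pos_subset hβ) (hR.simple_mem i)
        (eq_smul_of_S_notMem_pos hR hx haβ h)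
      rw [this] at hle
      exact Relation.ReflTransGen.trans hle (chainLE_dmulStep hR hx hb i)

/-- A Demazure product dominates the products over subwords. -/
theorem wordProd_mul_chainLE_dmulList (hR : R.IsRootSystem)
    {x : Fin R.r → Module.Dual ℚ R.V}
    (hx : ∀ i j : Fin R.r, x j (R.α i) = if i = j then 1 else 0) {v : R.Aut}
    (hv : v ∈ R.weylGroup) {m l : List (Fin R.r)} (h : m.Sublist l) :
    ChainLE (R.wordProd m * v) (R.dmulList l v) := by
  induction h with
  | slnil => exact Relation.ReflTransGen.refl
  | cons i _ ih =>
    exact Relation.ReflTransGen.trans ih (chainLE_dmulStep hR hx (dmulList_mem hv _) i)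
  | cons_cons i _ ih =>
    rw [wordProd_cons, mul_assoc]
    exact S_mul_chainLE_dmulStep hR hx (dmulList_mem hv _) ih i

/-- A Demazure product is attained by a subword. -/
theorem exists_sublist_dmulList_eq (l : List (Fin R.r)) (v : R.Aut) :
    ∃ m : List (Fin R.r), m.Sublist l ∧ R.dmulList l v = R.wordProd m * v := by
  induction l with
  | nil => exact ⟨[], List.Sublist.refl _, by simp [dmulList]⟩
  | cons i l ih =>
    obtain ⟨m, hm, h⟩ := ih
    have hcons : R.dmulList (i :: l) v = R.dmulStep i (R.dmulList l v) := rfl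
    rw [hcons, h]
    unfold dmulStep
    split_ifs
    · exact ⟨i :: m, hm.cons_cons i, by simp [mul_assoc]⟩
    · exact ⟨m, hm.cons i, rfl⟩

theorem Reduced.of_cons {i : Fin R.r} {l : List (Fin R.r)} (hR : R.IsRootSystem)
    (h : R.Reduced (i :: l)) : R.Reduced l := by
  refine le_antisymm (len_wordProd_le l) ?_
  obtain ⟨m, hm, hml⟩ := exists_reduced hR (wordProd_mem l)
  have h1 := len_wordProd_le (i :: m)
  rw [wordProd_cons, hml, ← wordProd_cons, h] at h1
  rw [← hml, hm]
  simpa using h1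

theorem dmulList_one_of_reduced (hR : R.IsRootSystem) {l : List (Fin R.r)}
    (h : R.Reduced l) : R.dmulList l 1 = R.wordProd l := by
  induction l with
  | nil => rfl
  | cons i l ih =>
    have hl := h.of_cons hR
    have hcons : R.dmulList (i :: l) 1 = R.dmulStep i (R.dmulList l 1) := rfl
    rw [hcons, ih hl, dmulStep, if_pos, wordProd_cons]
    rw [← wordProd_cons, h, hl]
    simp

theorem BruhatLE.chainLE (hR : R.IsRootSystem) {x : Fin R.r → Module.Dual ℚ R.V}
    (hx : ∀ i j : Fin R.r, x j (R.α i) = if i = j then 1 else 0) {a b : R.Aut}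
    (h : R.BruhatLE a b) : ChainLE a b := by
  obtain ⟨l, hl, rfl, m, hm, rfl⟩ := h
  have := wordProd_mul_chainLE_dmulList hR hx R.weylGroup.one_mem hm
  rwa [mul_one, dmulList_one_of_reduced hR hl] at this

/-- The subword property: elements below the product of a word are products of subwords. -/
theorem ChainLE.exists_sublist (hR : R.IsRootSystem) {x : Fin R.r → Module.Dual ℚ R.V}
    (hx : ∀ i j : Fin R.r, x j (R.α i) = if i = j then 1 else 0) {a : R.Aut}
    {l : List (Fin R.r)} (h : ChainLE a (R.wordProd l)) :
    ∃ m : List (Fin R.r), m.Sublist l ∧ R.wordProd m = a := by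
  induction h using Relation.ReflTransGen.head_induction_on with
  | refl => exact ⟨l, List.Sublist.refl l, rfl⟩
  | head hstep _ ih =>
    obtain ⟨-, β, hβ, haβ, rfl⟩ := hstep
    obtain ⟨m, hm, hprod⟩ := ih
    have hΦ := hR.pos_subset hβ
    obtain ⟨m', hm', -, h'⟩ := strong_exchange hR hx hβ m (by
      rw [hprod, LinearEquiv.mul_apply, s_self hR hΦ, map_neg]
      exact neg_notMem_pos hR haβ)
    exact ⟨m', hm'.trans hm, by rw [h', hprod, mul_assoc, s_mul_self hR hΦ, mul_one]⟩

/-- A `W`-invariant symmetric bilinear form on `V`. -/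
noncomputable def invForm (hR : R.IsRootSystem) (y z : R.V) : ℚ :=
  ∑ β ∈ hR.finite.toFinset, R.coroot β y * R.coroot β z

theorem invForm_s (hR : R.IsRootSystem) {γ : R.V} (hγ : γ ∈ R.Φ) (y z : R.V) :
    invForm hR (R.s γ y) (R.s γ z) = invForm hR y z := by
  have hmem := s_mem_rootAut hR hγ
  have hinv : (R.s γ)⁻¹ = R.s γ := inv_eq_of_mul_eq_one_left (s_mul_self hR hγ)
  refine Finset.sum_bij' (fun β _ => R.s γ β) (fun β _ => R.s γ β) ?_ ?_ ?_ ?_ ?_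
  · intro β hβ
    simpa using (hmem β).2 (by simpa using hβ)
  · intro β hβ
    simpa using (hmem β).2 (by simpa using hβ)
  · intro β _
    exact LinearEquiv.congr_fun (s_mul_self hR hγ) β
  · intro β _
    exact LinearEquiv.congr_fun (s_mul_self hR hγ) β
  · intro β hβ
    have hβ' : β ∈ R.Φ := by simpa using hβ
    have key := fun y => smul_coroot_comp_inv hR hmem hβ' ((hmem β).2 hβ') (c := 1)
      (one_smul _ _).symm y
    simp only [one_mul, hinv] at key
    rw [key, key]

theorem two_mul_invForm (hR : R.IsRootSystem) {γ : R.V} (hγ : γ ∈ R.Φ) (y : R.V) :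
    2 * invForm hR y γ = R.coroot γ y * invForm hR γ γ := by
  have h := invForm_s hR hγ y γ
  rw [s_self hR hγ, s_apply hR hγ] at h
  have h' : invForm hR (y - R.coroot γ y • γ) (-γ) =
      -invForm hR y γ + R.coroot γ y * invForm hR γ γ := by
    simp only [invForm, Finset.mul_sum, ← Finset.sum_neg_distrib, ← Finset.sum_add_distrib]
    refine Finset.sum_congr rfl fun β _ => ?_
    simp
    ring
  linarith

theorem invForm_self_pos (hR : R.IsRootSystem) {γ : R.V} (hγ : γ ∈ R.Φ) :
    0 < invForm hR γ γ := by
  refine Finset.sum_pos' (fun β _ => mul_self_nonneg _) ⟨γ, by simpa using hγ, ?_⟩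
  rw [hR.coroot_self γ hγ]
  norm_num

theorem Dominant.coroot_nonneg (hR : R.IsRootSystem) {lam : R.V} (hdom : R.Dominant lam)
    {γ : R.V} (hγ : γ ∈ R.pos) : 0 ≤ R.coroot γ lam := by
  have hΦ := hR.pos_subset hγ
  have hsimple : ∀ i, 0 ≤ invForm hR lam (R.α i) := fun i => by
    have h1 := two_mul_invForm hR (hR.simple_mem i) lam
    have h2 := mul_nonneg (hdom i) (invForm_self_pos hR (hR.simple_mem i)).le
    linarith
  have hform : 0 ≤ invForm hR lam γ := by
    obtain ⟨c, hc, hγc⟩ := hR.pos_nonneg_comb γ hγ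
    have : invForm hR lam γ = ∑ i, c i * invForm hR lam (R.α i) := by
      simp only [invForm, Finset.mul_sum]
      rw [Finset.sum_comm]
      refine Finset.sum_congr rfl fun β _ => ?_
      rw [hγc]
      simp only [map_sum, map_smul, smul_eq_mul, Finset.mul_sum]
      exact Finset.sum_congr rfl fun i _ => by ring
    rw [this]
    exact Finset.sum_nonneg fun i _ => mul_nonneg (hc i) (hsimple i)
  have h1 := two_mul_invForm hR hΦ lam
  exact nonneg_of_mul_nonneg_left (h1 ▸ by linarith) (invForm_self_pos hR hΦ)

/-- Pairings of a dominant weight with translates of a fundamental coweight decrease along the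
Bruhat order. -/
theorem ChainLE.coweight_le (hR : R.IsRootSystem) {x : Fin R.r → Module.Dual ℚ R.V}
    (hx : ∀ i j : Fin R.r, x j (R.α i) = if i = j then 1 else 0) {lam : R.V}
    (hdom : R.Dominant lam) {a b : R.Aut} (h : ChainLE a b) (j : Fin R.r) :
    x j (b⁻¹ lam) ≤ x j (a⁻¹ lam) := by
  induction h using Relation.ReflTransGen.head_induction_on with
  | refl => exact le_rfl
  | head hstep _ ih =>
    rename_i a c
    refine ih.trans ?_
    obtain ⟨ha, β, hβ, haβ, rfl⟩ := hstep
    have hΦ := hR.pos_subset hβ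
    rw [mul_inv_rev, inv_eq_of_mul_eq_one_left (s_mul_self hR hΦ), LinearEquiv.mul_apply,
      s_apply hR hΦ, map_sub, map_smul, smul_eq_mul]
    have h1 := smul_coroot_comp_inv hR ha hΦ (hR.pos_subset haβ) (c := 1)
      (one_smul _ _).symm lam
    rw [one_mul] at h1
    rw [h1]
    have := mul_nonneg (hdom.coroot_nonneg hR haβ) (coweight_nonneg hR hx hβ j)
    linarith

/-- Every functional is conjugate under the Weyl group to a dominant one. -/
theorem exists_conj_dominant (hR : R.IsRootSystem) {x : Fin R.r → Module.Dual ℚ R.V}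
    (hx : ∀ i j : Fin R.r, x j (R.α i) = if i = j then 1 else 0) (f : Module.Dual ℚ R.V) :
    ∃ v ∈ R.weylGroup, ∀ i, 0 ≤ f (v (R.α i)) := by
  have hfin : ∀ g : Module.Dual ℚ R.V, {β | β ∈ R.pos ∧ g β < 0}.Finite := fun g =>
    hR.finite.subset fun β hβ => hR.pos_subset hβ.1
  induction hn : {β | β ∈ R.pos ∧ f β < 0}.ncard using Nat.strong_induction_on generalizing f with
  | _ n ih =>
  by_cases hf : ∀ i, 0 ≤ f (R.α i)
  · exact ⟨1, R.weylGroup.one_mem, hf⟩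
  push Not at hf
  obtain ⟨i, hi⟩ := hf
  let g : Module.Dual ℚ R.V := f.comp (R.S i : R.V →ₗ[ℚ] R.V)
  have hlt : {β | β ∈ R.pos ∧ g β < 0}.ncard < n := by
    rw [← hn]
    have hsub : R.S i '' {β | β ∈ R.pos ∧ g β < 0} ⊂ {β | β ∈ R.pos ∧ f β < 0} := by
      refine (Set.ssubset_iff_of_subset ?_).2 ⟨R.α i, ⟨hR.simple_pos i, hi⟩, ?_⟩
      · rintro _ ⟨β, ⟨hβ, hg⟩, rfl⟩
        refine ⟨?_, hg⟩
        by_contra h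
        have hc := eq_smul_of_S_notMem_pos hR hx hβ h
        have hg' : f (R.S i β) < 0 := hg
        rw [hc, map_smul, S, s_self hR (hR.simple_mem i), map_smul, map_neg, smul_eq_mul] at hg'
        have := mul_nonneg (coweight_nonneg hR hx hβ i) (neg_nonneg.2 hi.le)
        linarith
      · rintro ⟨β, ⟨hβ, -⟩, h⟩
        have h1 := congrArg (R.S i) h
        rw [← LinearEquiv.mul_apply, S_mul_self hR, S, s_self hR (hR.simple_mem i)] at h1
        exact neg_notMem_pos hR (hR.simple_pos i) (h1 ▸ hβ)
    rw [← Set.ncard_image_of_injective _ (R.S i).injective]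
    exact Set.ncard_lt_ncard hsub (hfin f)
  obtain ⟨v, hv, h⟩ := ih _ hlt g rfl
  exact ⟨R.S i * v, R.weylGroup.mul_mem (S_mem_weylGroup i) hv, h⟩

theorem WPar_le_weylGroup (i : Fin R.r) : R.WPar i ≤ R.weylGroup :=
  Subgroup.closure_mono (Set.image_subset_range _ _)

theorem exists_isMinRep {a : R.Aut} (ha : a ∈ R.weylGroup) (i : Fin R.r) :
    ∃ u, R.IsMinRep i u a := by
  have hne : {n | ∃ p ∈ R.WPar i, R.len (a * p) = n}.Nonempty :=
    ⟨_, 1, (R.WPar i).one_mem, rfl⟩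
  obtain ⟨p, hp, hlen⟩ := Nat.sInf_mem hne
  refine ⟨a * p, ⟨R.weylGroup.mul_mem ha (WPar_le_weylGroup i hp), fun q hq => ?_⟩, ?_⟩
  · rw [hlen]
    exact Nat.sInf_le ⟨p * q, (R.WPar i).mul_mem hp hq, by rw [mul_assoc]⟩
  · rw [mul_inv_rev, mul_assoc, inv_mul_cancel, mul_one]
    exact (R.WPar i).inv_mem hp

theorem coweight_WPar (hR : R.IsRootSystem) {x : Fin R.r → Module.Dual ℚ R.V}
    (hx : ∀ i j : Fin R.r, x j (R.α i) = if i = j then 1 else 0) {i : Fin R.r} {p : R.Aut}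
    (hp : p ∈ R.WPar i) (y : R.V) : x i (p y) = x i y := by
  induction hp using Subgroup.closure_induction generalizing y with
  | mem p hp =>
    obtain ⟨j, hj, rfl⟩ := hp
    rw [S_apply hR, map_sub, map_smul, hx, if_neg hj, smul_zero, sub_zero]
  | one => rfl
  | mul p q _ _ hp hq => rw [LinearEquiv.mul_apply, hp, hq]
  | inv p _ hp =>
    rw [← hp, ← LinearEquiv.mul_apply, mul_inv_cancel]
    rfl

theorem IsMinRep.coweight_eq (hR : R.IsRootSystem) {x : Fin R.r → Module.Dual ℚ R.V}
    (hx : ∀ i j : Fin R.r, x j (R.α i) = if i = j then 1 else 0) {i : Fin R.r} {u a : R.Aut}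
    (h : R.IsMinRep i u a) (y : R.V) : x i (u⁻¹ y) = x i (a⁻¹ y) := by
  have := coweight_WPar hR hx h.2 (a⁻¹ y)
  rwa [← LinearEquiv.mul_apply, mul_assoc, mul_inv_cancel, mul_one] at this

theorem dmul_eq_dmulList (hR : R.IsRootSystem) {a : R.Aut} (ha : a ∈ R.weylGroup) :
    ∃ l, R.Reduced l ∧ R.wordProd l = a ∧ ∀ v, R.dmul a v = R.dmulList l v := by
  have h := exists_reduced hR ha
  exact ⟨h.choose, h.choose_spec.1, h.choose_spec.2, fun v => by rw [dmul, dif_pos h]⟩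

end RootData

theorem statement3 (R : RootData) (hR : R.IsRootSystem)
    (x : Fin R.r → Module.Dual ℚ R.V)
    (hx : ∀ i j : Fin R.r, x j (R.α i) = if i = j then 1 else 0)
    (lam : R.V) (hdom : R.Dominant lam)
    (w : R.Aut) (hw : w ∈ R.weylGroup) (mu : R.V) :
    mu ∈ R.demPolytope lam w ↔
      ∀ (i : Fin R.r) (v u : R.Aut), v ∈ R.minReps i →
        R.IsMinRep i u (R.dmul w⁻¹ v) →
        R.dualAct u (x i) lam ≤ R.dualAct v (x i) mu := by
  obtain ⟨l, hl, hlw, hdmul⟩ := RootData.dmul_eq_dmulList hR (R.weylGroup.inv_mem hw)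
  have hlrev : R.wordProd l.reverse = w := by rw [RootData.wordProd_reverse hR, hlw, inv_inv]
  have hredrev : R.Reduced l.reverse := by
    rw [RootData.Reduced, hlrev, ← RootData.len_inv hR hw, ← hlw, hl, List.length_reverse]
  constructor
  · intro hmu i v u hv hu
    have hsub : R.demPolytope lam w ⊆ {m | x i (u⁻¹ lam) ≤ x i (v⁻¹ m)} := by
      refine convexHull_min ?_ ?_
      · rintro _ ⟨a, -, ha, rfl⟩
        obtain ⟨m, hm, rfl⟩ :=
          RootData.ChainLE.exists_sublist hR hx (hlrev.symm ▸ ha.chainLE hR hx)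
        have hm' : m.reverse.Sublist l := by simpa using hm.reverse
        have h := (RootData.wordProd_mul_chainLE_dmulList hR hx hv.1 hm').coweight_le
          hR hx hdom i
        rw [RootData.wordProd_reverse hR, mul_inv_rev, inv_inv, ← hdmul] at h
        change x i (u⁻¹ lam) ≤ _
        rw [hu.coweight_eq hR hx]
        exact h
      · exact convex_halfSpace_ge
          ((x i).comp ((v⁻¹ : R.Aut) : R.V →ₗ[ℚ] R.V)).isLinear _
    exact hsub hmu
  · intro hineq
    by_contra hmu
    let F : Set R.V := {m | ∃ a ∈ {a | a ∈ l.reverse.sublists}, R.wordProd a lam = m}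
    have hFfin : F.Finite := (List.finite_toSet l.reverse.sublists).image _
    have hFsub : F ⊆ {m | ∃ a : R.Aut, a ∈ R.weylGroup ∧ R.BruhatLE a w ∧ m = a lam} := by
      rintro _ ⟨a, ha, rfl⟩
      exact ⟨_, RootData.wordProd_mem a,
        ⟨l.reverse, hredrev, hlrev, a, List.mem_sublists.1 ha, rfl⟩, rfl⟩
    obtain ⟨f, hf⟩ := exists_dual_lt_of_notMem_convexHull hFfin
      fun h => hmu (convexHull_mono hFsub h)
    obtain ⟨v, hv, hfv⟩ := RootData.exists_conj_dominant hR hx f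
    have hexpand : ∀ y, f y = ∑ i, x i (v⁻¹ y) * f (v (R.α i)) := fun y => by
      have h : v (v⁻¹ y) = y := by rw [← LinearEquiv.mul_apply, mul_inv_cancel]; rfl
      conv_lhs => rw [← h, RootData.eq_sum_coweight hR hx (v⁻¹ y)]
      simp
    obtain ⟨m, hm, hmv⟩ := RootData.exists_sublist_dmulList_eq l v
    have hlt := hf (R.wordProd m.reverse lam)
      ⟨m.reverse, List.mem_sublists.2 hm.reverse, rfl⟩
    refine absurd hlt (not_lt.2 ?_)
    rw [hexpand, hexpand mu]
    refine Finset.sum_le_sum fun i _ => mul_le_mul_of_nonneg_right ?_ (hfv i)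
    obtain ⟨vi, hvi⟩ := RootData.exists_isMinRep hv i
    obtain ⟨ui, hui⟩ := RootData.exists_isMinRep (RootData.dmulList_mem hvi.1.1 l) i
    have h1 : x i (ui⁻¹ lam) ≤ x i (vi⁻¹ mu) :=
      hineq i vi ui hvi.1 (by rw [hdmul]; exact hui)
    obtain ⟨p, hp, hpv⟩ := RootData.exists_sublist_dmulList_eq l vi
    have h2 := (RootData.wordProd_mul_chainLE_dmulList hR hx hv hp).coweight_le hR hx hdom i
    rw [hui.coweight_eq hR hx, hvi.coweight_eq hR hx, hpv, mul_inv_rev, LinearEquiv.mul_apply,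
      hvi.coweight_eq hR hx] at h1
    rw [hmv, mul_inv_rev, mul_inv_rev, LinearEquiv.mul_apply, LinearEquiv.mul_apply] at h2
    rw [RootData.wordProd_reverse hR]
    exact h2.trans h1
end

section
/- Let λ ∈ V be a dominant weight and w ∈ W. For v ∈ W set μ_v := v·(v⁻¹ * w)·λ, and for μ ∈ V define the cone C_v^μ := {ν ∈ V : ⟨ν, v x_i⟩ ≥ ⟨μ, v x_i⟩ for all 1 ≤ i ≤ r}. Then: (1) P_λ^w = ⋂_{v ∈ W} C_v^{μ_v}; and (2) for all v_1, v_2 ∈ W, the difference v_1⁻¹ μ_{v_2} − v_1⁻¹ μ_{v_1} is a nonnegative rational linear combination of the simple roots. -/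
open scoped Classical

/-- **Farkas' lemma** over an ordered field: either `b` lies in the cone generated by finitely many
vectors, or some linear functional separates it from that cone. -/
theorem farkas {k V ι : Type*} [Field k] [LinearOrder k] [IsStrictOrderedRing k] [AddCommGroup V]
    [Module k V] (t : Finset ι) (a : ι → V) (b : V) :
    (∃ c : ι → k, (∀ i ∈ t, 0 ≤ c i) ∧ b = ∑ i ∈ t, c i • a i) ∨
      ∃ f : Module.Dual k V, (∀ i ∈ t, 0 ≤ f (a i)) ∧ f b < 0 := by
  induction t using Finset.induction_on generalizing a b with
  | empty =>
    by_cases hb : b = 0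
    · exact Or.inl ⟨0, by simp, by simp [hb]⟩
    · obtain ⟨f, hf⟩ : ∃ f : Module.Dual k V, f b ≠ 0 := by
        by_contra! h
        exact hb ((Module.forall_dual_apply_eq_zero_iff k b).1 h)
      rcases lt_or_gt_of_ne hf with h | h
      · exact Or.inr ⟨f, by simp, h⟩
      · exact Or.inr ⟨-f, by simp, by simpa using h⟩
  | insert j t hj ih =>
    rcases ih a b with ⟨c, hc, hb⟩ | ⟨f, hf, hfb⟩
    · refine Or.inl ⟨Function.update c j 0, ?_, ?_⟩
      · intro i hi
        by_cases hij : i = j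
        · simp [hij]
        · simpa [hij] using hc i (Finset.mem_of_mem_insert_of_ne hi hij)
      · rw [Finset.sum_insert hj, hb, Function.update_self, zero_smul, zero_add]
        refine Finset.sum_congr rfl fun i hi => ?_
        rw [Function.update_of_ne (ne_of_mem_of_not_mem hi hj)]
    by_cases hfj : 0 ≤ f (a j)
    · exact Or.inr ⟨f, by simpa using ⟨hfj, hf⟩, hfb⟩
    have hneg : f (a j) < 0 := not_le.1 hfj
    set e : k := -(f (a j))⁻¹ with he
    have he0 : 0 < e := by rw [he]; simpa using hneg
    have hea : e * f (a j) = -1 := by rw [he, neg_mul, inv_mul_cancel₀ hneg.ne]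
    let p : V →ₗ[k] V := LinearMap.id + (e • f).smulRight (a j)
    have hp : ∀ y, p y = y + (e * f y) • a j := fun y => by simp [p]
    rcases ih (fun i => p (a i)) (p b) with ⟨c, hc, hb⟩ | ⟨g, hg, hgb⟩
    · refine Or.inl ⟨Function.update c j (∑ i ∈ t, c i * (e * f (a i)) - e * f b), ?_, ?_⟩
      · intro i hi
        by_cases hij : i = j
        · subst hij
          rw [Function.update_self]
          have h1 : 0 ≤ ∑ i ∈ t, c i * (e * f (a i)) := Finset.sum_nonneg fun i hi =>
            mul_nonneg (hc i hi) (mul_nonneg he0.le (hf i hi))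
          have h2 : e * f b < 0 := mul_neg_of_pos_of_neg he0 hfb
          linarith
        · simpa [hij] using hc i (Finset.mem_of_mem_insert_of_ne hi hij)
      · have h1 : ∑ i ∈ t, Function.update c j (∑ i ∈ t, c i * (e * f (a i)) - e * f b) i • a i
            = ∑ i ∈ t, c i • a i := Finset.sum_congr rfl fun i hi => by
          rw [Function.update_of_ne (ne_of_mem_of_not_mem hi hj)]
        rw [Finset.sum_insert hj, Function.update_self, h1]
        simp only [hp, smul_add, Finset.sum_add_distrib, smul_smul] at hb
        rw [← Finset.sum_smul] at hb
        rw [sub_smul, ← add_left_inj ((e * f b) • a j), hb]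
        abel
    · refine Or.inr ⟨g ∘ₗ p, ?_, by simpa using hgb⟩
      intro i hi
      by_cases hij : i = j
      · subst hij
        simp [hp, hea]
      · exact hg i (Finset.mem_of_mem_insert_of_ne hi hij)

/-- A point outside the convex hull of a finite set is separated from it by a functional. -/
theorem exists_dual_lt_of_notMem_convexHull_s11 {k V : Type*} [Field k] [LinearOrder k]
    [IsStrictOrderedRing k] [AddCommGroup V] [Module k V] {t : Set V} (ht : t.Finite) {b : V}
    (hb : b ∉ convexHull k t) : ∃ f : Module.Dual k V, ∀ p ∈ t, f b < f p := by
  rcases farkas (k := k) ht.toFinset (fun p : V => (p, (1 : k))) (b, 1) with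
    ⟨c, hc, h⟩ | ⟨f, hf, hfb⟩
  · refine absurd ?_ hb
    have h1 := congrArg Prod.fst h
    have h2 := congrArg Prod.snd h
    simp only [Prod.fst_sum, Prod.snd_sum, Prod.smul_fst, Prod.smul_snd, smul_eq_mul,
      mul_one] at h1 h2
    rw [h1]
    exact (convex_convexHull k t).sum_mem hc h2.symm fun i hi =>
      subset_convexHull k t (ht.mem_toFinset.1 hi)
  · refine ⟨f ∘ₗ LinearMap.inl k V k, fun p hp => ?_⟩
    have key : ∀ y : V, f (y, 1) = f (y, 0) + f (0, 1) := fun y => by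
      rw [← map_add]; simp
    have h1 := hf p (ht.mem_toFinset.2 hp)
    rw [key] at h1 hfb
    simp only [LinearMap.comp_apply, LinearMap.inl_apply]
    linarith

namespace RootData.IsRootSystem

variable {R : RootData}

section Reflections

lemma s_apply (hR : R.IsRootSystem) {β : R.V} (hβ : β ∈ R.Φ) (y : R.V) :
    R.s β y = y - R.coroot β y • β := by
  have h : (R.reflMap β).comp (R.reflMap β) = LinearMap.id := by
    ext y
    simp only [reflMap, LinearMap.comp_apply, LinearMap.sub_apply, LinearMap.id_apply,
      LinearMap.smulRight_apply, map_sub, map_smul, hR.coroot_self β hβ]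
    module
  rw [RootData.s, dif_pos h]
  simp [reflMap]

lemma s_s (hR : R.IsRootSystem) {β : R.V} (hβ : β ∈ R.Φ) (y : R.V) : R.s β (R.s β y) = y := by
  simp only [hR.s_apply hβ, map_sub, map_smul, hR.coroot_self β hβ, smul_eq_mul]
  module

lemma s_mul_self (hR : R.IsRootSystem) {β : R.V} (hβ : β ∈ R.Φ) : R.s β * R.s β = 1 := by
  ext y
  exact hR.s_s hβ y

lemma s_self (hR : R.IsRootSystem) {β : R.V} (hβ : β ∈ R.Φ) : R.s β β = -β := by
  rw [hR.s_apply hβ, hR.coroot_self β hβ]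
  module

lemma s_mem (hR : R.IsRootSystem) {β γ : R.V} (hβ : β ∈ R.Φ) (hγ : γ ∈ R.Φ) : R.s β γ ∈ R.Φ := by
  rw [hR.s_apply hβ]
  exact hR.reflection_stable β hβ γ hγ

lemma coroot_s (hR : R.IsRootSystem) {β γ : R.V} (hβ : β ∈ R.Φ) (hγ : γ ∈ R.Φ) (y : R.V) :
    R.coroot (R.s γ β) y = R.coroot β (R.s γ y) := by
  have hm := hR.s_mem hγ hβ
  have : R.coroot (R.s γ β) = (R.coroot β) ∘ₗ (R.s γ : R.V →ₗ[ℚ] R.V) := by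
    refine Module.Dual.eq_of_preReflection_mapsTo (x := R.s γ β) hR.finite hR.span_top
      (hR.coroot_self _ hm) ?_ ?_ ?_
    · intro δ hδ
      exact hR.reflection_stable _ hm δ hδ
    · simpa [hR.s_s hγ] using hR.coroot_self β hβ
    · intro δ hδ
      have h := hR.s_mem hγ (hR.reflection_stable β hβ _ (hR.s_mem hγ hδ))
      rw [map_sub, map_smul, hR.s_s hγ] at h
      simpa [Module.preReflection_apply] using h
  rw [this]
  rfl

/-- The invariant form `(y, z) ↦ ∑_β ⟨y, β^∨⟩ ⟨z, β^∨⟩` on the ambient space. -/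
noncomputable def form (hR : R.IsRootSystem) (y z : R.V) : ℚ :=
  ∑ β ∈ hR.finite.toFinset, R.coroot β y * R.coroot β z

lemma form_comm (hR : R.IsRootSystem) (y z : R.V) : hR.form y z = hR.form z y := by
  simp only [form, mul_comm]

lemma form_sub_left (hR : R.IsRootSystem) (y y' z : R.V) :
    hR.form (y - y') z = hR.form y z - hR.form y' z := by
  simp only [form, map_sub, sub_mul, Finset.sum_sub_distrib]

lemma form_smul_left (hR : R.IsRootSystem) (c : ℚ) (y z : R.V) :
    hR.form (c • y) z = c * hR.form y z := by
  simp only [form, map_smul, smul_eq_mul, mul_assoc, Finset.mul_sum]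

lemma form_smul_right (hR : R.IsRootSystem) (c : ℚ) (y z : R.V) :
    hR.form y (c • z) = c * hR.form y z := by
  rw [form_comm, form_smul_left, form_comm]

lemma form_neg_right (hR : R.IsRootSystem) (y z : R.V) : hR.form y (-z) = -hR.form y z := by
  simp only [form, map_neg, mul_neg, Finset.sum_neg_distrib]

lemma form_sum_right (hR : R.IsRootSystem) {ι : Type*} (t : Finset ι) (y : R.V) (z : ι → R.V) :
    hR.form y (∑ i ∈ t, z i) = ∑ i ∈ t, hR.form y (z i) := by
  simp only [form, map_sum, Finset.mul_sum]
  exact Finset.sum_comm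

lemma form_s (hR : R.IsRootSystem) {γ : R.V} (hγ : γ ∈ R.Φ) (y z : R.V) :
    hR.form (R.s γ y) (R.s γ z) = hR.form y z := by
  refine Finset.sum_nbij' (R.s γ) (R.s γ) ?_ ?_ ?_ ?_ ?_
  · intro β hβ
    simpa using hR.s_mem hγ (by simpa using hβ)
  · intro β hβ
    simpa using hR.s_mem hγ (by simpa using hβ)
  · intro β _
    exact hR.s_s hγ β
  · intro β _
    exact hR.s_s hγ β
  · intro β hβ
    have hβ' : β ∈ R.Φ := by simpa using hβ
    rw [hR.coroot_s hβ' hγ, hR.coroot_s hβ' hγ]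

lemma form_self_pos (hR : R.IsRootSystem) {β : R.V} (hβ : β ∈ R.Φ) : 0 < hR.form β β := by
  refine Finset.sum_pos' (fun γ _ => mul_self_nonneg _) ⟨β, by simpa using hβ, ?_⟩
  rw [hR.coroot_self β hβ]
  norm_num

lemma coroot_eq (hR : R.IsRootSystem) {β : R.V} (hβ : β ∈ R.Φ) (y : R.V) :
    R.coroot β y = 2 * hR.form y β / hR.form β β := by
  have h := hR.form_s hβ y β
  rw [hR.s_self hβ, hR.form_neg_right, hR.s_apply hβ, form_sub_left, form_smul_left] at h
  rw [eq_div_iff (hR.form_self_pos hβ).ne']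
  linarith

lemma s_eq_of_eq_smul (hR : R.IsRootSystem) {β γ : R.V} (hβ : β ∈ R.Φ) (hγ : γ ∈ R.Φ) {c : ℚ}
    (h : β = c • γ) :
    R.s β = R.s γ := by
  have hc : c ≠ 0 := by
    rintro rfl
    exact hR.ne_zero β hβ (by simpa using h)
  have h0 := (hR.form_self_pos hγ).ne'
  ext y
  rw [hR.s_apply hβ, hR.s_apply hγ, hR.coroot_eq hβ, hR.coroot_eq hγ, h, form_smul_right,
    form_smul_left, form_smul_right, smul_smul]
  congr 2
  field_simp

lemma neg_mem_pos (hR : R.IsRootSystem) {β : R.V} (hβ : β ∈ R.Φ) (h : β ∉ R.pos) : -β ∈ R.pos := by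
  rcases hR.pos_or_neg β hβ with h' | h'
  · exact absurd h'.1 h
  · exact h'.2

lemma neg_notMem_pos (hR : R.IsRootSystem) {β : R.V} (h : β ∈ R.pos) : -β ∉ R.pos := by
  rcases hR.pos_or_neg β (hR.pos_subset h) with h' | h'
  · exact h'.2
  · exact absurd h h'.1

lemma eq_smul_of_S_notMem_pos (hR : R.IsRootSystem) {β : R.V} (hβ : β ∈ R.pos) {i : Fin R.r}
    (h : R.S i β ∉ R.pos) :
    ∃ c : ℚ, 0 ≤ c ∧ β = c • R.α i := by
  have hn := hR.neg_mem_pos (hR.s_mem (hR.simple_mem i) (hR.pos_subset hβ)) h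
  obtain ⟨c, hc, hcβ⟩ := hR.pos_nonneg_comb _ hβ
  obtain ⟨d, hd, hdβ⟩ := hR.pos_nonneg_comb _ hn
  rw [hR.s_apply (hR.simple_mem i)] at hdβ
  set q := R.coroot (R.α i) β with hq
  have hz : ∑ j, (c j + d j - if j = i then q else 0) • R.α j = 0 := by
    simp only [sub_smul, add_smul, Finset.sum_sub_distrib, Finset.sum_add_distrib, ite_smul,
      zero_smul, Finset.sum_ite_eq', Finset.mem_univ, if_true]
    rw [← hcβ, ← hdβ]
    abel
  have hz' := Fintype.linearIndependent_iff.1 hR.indep _ hz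
  refine ⟨c i, hc i, ?_⟩
  rw [hcβ, Finset.sum_eq_single i]
  · intro j _ hj
    have h1 := hz' j
    rw [if_neg hj] at h1
    have h2 : c j = 0 := by linarith [hc j, hd j]
    rw [h2, zero_smul]
  · simp

lemma s_eq_S_of_S_notMem_pos (hR : R.IsRootSystem) {β : R.V} (hβ : β ∈ R.pos) {i : Fin R.r}
    (h : R.S i β ∉ R.pos) :
    R.s β = R.S i := by
  obtain ⟨c, -, hc⟩ := hR.eq_smul_of_S_notMem_pos hβ h
  exact hR.s_eq_of_eq_smul (hR.pos_subset hβ) (hR.simple_mem i) hc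

lemma S_mul_self (hR : R.IsRootSystem) (i : Fin R.r) : R.S i * R.S i = 1 :=
  hR.s_mul_self (hR.simple_mem i)

lemma S_S (hR : R.IsRootSystem) (i : Fin R.r) (y : R.V) : R.S i (R.S i y) = y :=
  hR.s_s (hR.simple_mem i) y

lemma S_inv (hR : R.IsRootSystem) (i : Fin R.r) : (R.S i)⁻¹ = R.S i :=
  inv_eq_of_mul_eq_one_left (hR.S_mul_self i)

lemma S_simple (hR : R.IsRootSystem) (i : Fin R.r) : R.S i (R.α i) = -R.α i :=
  hR.s_self (hR.simple_mem i)

lemma span_simple (hR : R.IsRootSystem) : Submodule.span ℚ (Set.range R.α) = ⊤ := by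
  have hpos : ∀ β ∈ R.pos, β ∈ Submodule.span ℚ (Set.range R.α) := by
    intro β hβ
    obtain ⟨c, -, rfl⟩ := hR.pos_nonneg_comb β hβ
    exact Submodule.sum_mem _ fun i _ =>
      Submodule.smul_mem _ _ (Submodule.subset_span ⟨i, rfl⟩)
  rw [eq_top_iff, ← hR.span_top, Submodule.span_le]
  intro β hβ
  by_cases h : β ∈ R.pos
  · exact hpos β h
  · simpa using Submodule.neg_mem _ (hpos _ (hR.neg_mem_pos hβ h))

end Reflections

section Weyl

lemma S_mem_weylGroup (i : Fin R.r) : R.S i ∈ R.weylGroup := Subgroup.subset_closure ⟨i, rfl⟩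

lemma wordProd_cons (i : Fin R.r) (l : List (Fin R.r)) :
    R.wordProd (i :: l) = R.S i * R.wordProd l := by
  simp [wordProd]

lemma wordProd_mem (l : List (Fin R.r)) : R.wordProd l ∈ R.weylGroup := by
  refine Subgroup.list_prod_mem _ fun g hg => ?_
  obtain ⟨i, -, rfl⟩ := List.mem_map.1 hg
  exact S_mem_weylGroup i

lemma exists_word (hR : R.IsRootSystem) {w : R.Aut} (hw : w ∈ R.weylGroup) :
    ∃ l : List (Fin R.r), R.wordProd l = w := by
  induction hw using Subgroup.closure_induction with
  | mem g hg =>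
    obtain ⟨i, rfl⟩ := hg
    exact ⟨[i], by simp [wordProd]⟩
  | one => exact ⟨[], rfl⟩
  | mul g h _ _ ihg ihh =>
    obtain ⟨l, rfl⟩ := ihg
    obtain ⟨m, rfl⟩ := ihh
    exact ⟨l ++ m, by simp [wordProd]⟩
  | inv g _ ih =>
    obtain ⟨l, rfl⟩ := ih
    refine ⟨l.reverse, ?_⟩
    rw [wordProd, wordProd, List.prod_inv_reverse, List.map_map, List.map_reverse]
    congr 2
    exact List.map_congr_left fun i _ => (hR.S_inv i).symm

lemma weyl_mem (hR : R.IsRootSystem) {g : R.Aut} (hg : g ∈ R.weylGroup) {β : R.V} (hβ : β ∈ R.Φ) :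
    g β ∈ R.Φ := by
  obtain ⟨l, rfl⟩ := hR.exists_word hg
  clear hg
  induction l with
  | nil => exact hβ
  | cons i l ih =>
    rw [wordProd_cons]
    exact hR.s_mem (hR.simple_mem i) ih

lemma form_weyl (hR : R.IsRootSystem) {g : R.Aut} (hg : g ∈ R.weylGroup) (y z : R.V) :
    hR.form (g y) (g z) = hR.form y z := by
  obtain ⟨l, rfl⟩ := hR.exists_word hg
  clear hg
  induction l with
  | nil => rfl
  | cons i l ih =>
    rw [wordProd_cons]
    exact (hR.form_s (hR.simple_mem i) _ _).trans ih

lemma s_weyl (hR : R.IsRootSystem) {g : R.Aut} (hg : g ∈ R.weylGroup) {β : R.V} (hβ : β ∈ R.Φ) :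
    R.s (g β) * g = g * R.s β := by
  ext y
  simp only [LinearEquiv.mul_apply]
  rw [hR.s_apply hβ, hR.s_apply (hR.weyl_mem hg hβ), hR.coroot_eq hβ,
    hR.coroot_eq (hR.weyl_mem hg hβ), hR.form_weyl hg, hR.form_weyl hg, map_sub, map_smul]

/-- **Strong exchange condition**, for a word that need not be reduced. -/
lemma exchange (hR : R.IsRootSystem) (l : List (Fin R.r)) {β : R.V} (hβ : β ∈ R.pos)
    (h : (R.wordProd l)⁻¹ β ∉ R.pos) :
    ∃ l' : List (Fin R.r), l'.Sublist l ∧ l'.length < l.length ∧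
      R.wordProd l' = R.s β * R.wordProd l := by
  induction l generalizing β with
  | nil => exact absurd hβ h
  | cons j l ih =>
    by_cases hj : R.S j β ∈ R.pos
    · rw [wordProd_cons, mul_inv_rev, hR.S_inv] at h
      obtain ⟨l', hl, hlen, hprod⟩ := ih hj h
      refine ⟨j :: l', hl.cons_cons j, by simpa using hlen, ?_⟩
      have hconj := hR.s_weyl (S_mem_weylGroup j) (hR.pos_subset hβ)
      rw [wordProd_cons, wordProd_cons, hprod]
      calc R.S j * (R.s (R.S j β) * R.wordProd l)
          = R.S j * (R.s (R.S j β) * R.S j * (R.S j * R.wordProd l)) := by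
            rw [mul_assoc, ← mul_assoc (R.S j) (R.S j), hR.S_mul_self, one_mul]
        _ = R.s β * (R.S j * R.wordProd l) := by
            rw [hconj, mul_assoc, ← mul_assoc (R.S j) (R.S j), hR.S_mul_self, one_mul]
    · refine ⟨l, List.sublist_cons_self j l, by simp, ?_⟩
      rw [hR.s_eq_S_of_S_notMem_pos hβ hj, wordProd_cons, ← mul_assoc, hR.S_mul_self, one_mul]

lemma len_wordProd_le (l : List (Fin R.r)) : R.len (R.wordProd l) ≤ l.length :=
  Nat.sInf_le ⟨l, rfl, rfl⟩

lemma exists_reduced (hR : R.IsRootSystem) {w : R.Aut} (hw : w ∈ R.weylGroup) :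
    ∃ l : List (Fin R.r), R.Reduced l ∧ R.wordProd l = w := by
  obtain ⟨m, hm⟩ := hR.exists_word hw
  obtain ⟨l, hl, rfl⟩ := Nat.sInf_mem
    (s := {n | ∃ l : List (Fin R.r), l.length = n ∧ R.wordProd l = w}) ⟨_, m, rfl, hm⟩
  exact ⟨l, hl.symm, rfl⟩

lemma reduced_of_cons (hR : R.IsRootSystem) {i : Fin R.r} {l : List (Fin R.r)} (h : R.Reduced
    (i :: l)) :
    R.Reduced l := by
  obtain ⟨m, hm, hml⟩ := hR.exists_reduced (wordProd_mem l)
  refine le_antisymm (len_wordProd_le l) ?_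
  have h1 := len_wordProd_le (i :: m)
  rw [wordProd_cons, hml, ← wordProd_cons, h] at h1
  rw [Reduced, hml] at hm
  rw [hm]
  simpa using h1

lemma len_S_mul_lt (hR : R.IsRootSystem) {g : R.Aut} (hg : g ∈ R.weylGroup) {i : Fin R.r}
    (h : g⁻¹ (R.α i) ∉ R.pos) : R.len (R.S i * g) < R.len g := by
  obtain ⟨l, hl, rfl⟩ := hR.exists_reduced hg
  obtain ⟨l', -, hlen, hprod⟩ := hR.exchange l (hR.simple_pos i) h
  have hle := len_wordProd_le l'
  rw [hprod] at hle
  rw [hl]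
  exact hle.trans_lt hlen

lemma inv_S_mul_simple (hR : R.IsRootSystem) (i : Fin R.r) (g : R.Aut) :
    (R.S i * g)⁻¹ (R.α i) = -g⁻¹ (R.α i) := by
  rw [mul_inv_rev, hR.S_inv, LinearEquiv.mul_apply, hR.S_simple, map_neg]

lemma len_lt_len_S_mul_iff (hR : R.IsRootSystem) {g : R.Aut} (hg : g ∈ R.weylGroup) (i : Fin R.r) :
    R.len g < R.len (R.S i * g) ↔ g⁻¹ (R.α i) ∈ R.pos := by
  constructor
  · intro h
    by_contra hn
    exact absurd (hR.len_S_mul_lt hg hn) h.asymm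
  · intro h
    have h1 : (R.S i * g)⁻¹ (R.α i) ∉ R.pos := by
      rw [hR.inv_S_mul_simple]
      exact hR.neg_notMem_pos h
    have h2 := hR.len_S_mul_lt (mul_mem (S_mem_weylGroup i) hg) h1
    rwa [← mul_assoc, hR.S_mul_self, one_mul] at h2

lemma inv_simple_mem_pos_of_reduced (hR : R.IsRootSystem) {i : Fin R.r} {l : List (Fin R.r)}
    (h : R.Reduced (i :: l)) : (R.wordProd l)⁻¹ (R.α i) ∈ R.pos := by
  rw [← hR.len_lt_len_S_mul_iff (wordProd_mem l), ← wordProd_cons, h, hR.reduced_of_cons h]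
  simp

end Weyl

section Bruhat

/-- A step `a < s_β a` of the Bruhat order, where `β` is a positive root. -/
def BruhatStep (R : RootData) (a b : R.Aut) : Prop :=
  a ∈ R.weylGroup ∧ ∃ β ∈ R.pos, a⁻¹ β ∈ R.pos ∧ b = R.s β * a

/-- The Bruhat order described by chains of reflections. -/
abbrev BruhatChain (R : RootData) : R.Aut → R.Aut → Prop :=
  Relation.ReflTransGen (BruhatStep R)

lemma dmulStep_mem (i : Fin R.r) {y : R.Aut} (hy : y ∈ R.weylGroup) :
    R.dmulStep i y ∈ R.weylGroup := by
  unfold dmulStep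
  split_ifs
  · exact mul_mem (S_mem_weylGroup i) hy
  · exact hy

lemma dmulList_mem (l : List (Fin R.r)) {y : R.Aut} (hy : y ∈ R.weylGroup) :
    R.dmulList l y ∈ R.weylGroup := by
  induction l with
  | nil => exact hy
  | cons i l ih => exact dmulStep_mem i ih

lemma chain_dmulStep (hR : R.IsRootSystem) (i : Fin R.r) {y : R.Aut} (hy : y ∈ R.weylGroup) :
    BruhatChain R y (R.dmulStep i y) := by
  unfold dmulStep
  split_ifs with h
  · exact .single ⟨hy, R.α i, hR.simple_pos i, (hR.len_lt_len_S_mul_iff hy i).1 h, rfl⟩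
  · exact .refl

lemma chain_S_mul_dmulStep (hR : R.IsRootSystem) (i : Fin R.r) {a y : R.Aut} (hy : y ∈ R.weylGroup)
    (h : BruhatChain R a y) : BruhatChain R (R.S i * a) (R.dmulStep i y) := by
  induction h using Relation.ReflTransGen.head_induction_on with
  | refl =>
    unfold dmulStep
    split_ifs with h
    · exact .refl
    · have hn := mt (hR.len_lt_len_S_mul_iff hy i).2 h
      refine .single ⟨mul_mem (S_mem_weylGroup i) hy, R.α i, hR.simple_pos i, ?_, ?_⟩
      · rw [hR.inv_S_mul_simple]
        exact hR.neg_mem_pos (hR.weyl_mem (inv_mem hy) (hR.simple_mem i)) hn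
      · change y = R.S i * (R.S i * y)
        rw [← mul_assoc, hR.S_mul_self, one_mul]
  | head hstep htail ih =>
    obtain ⟨ha, β, hβ, haβ, rfl⟩ := hstep
    by_cases hj : R.S i β ∈ R.pos
    · refine .head ⟨mul_mem (S_mem_weylGroup i) ha, R.S i β, hj, ?_, ?_⟩ ih
      · rw [mul_inv_rev, hR.S_inv, LinearEquiv.mul_apply, hR.S_S]
        exact haβ
      · rw [← mul_assoc, ← mul_assoc, hR.s_weyl (S_mem_weylGroup i) (hR.pos_subset hβ)]
    · rw [hR.s_eq_S_of_S_notMem_pos hβ hj] at htail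
      exact htail.trans (hR.chain_dmulStep i hy)

lemma chain_wordProd_mul_dmulList (hR : R.IsRootSystem) (l : List (Fin R.r)) {u w : R.Aut}
    (hw : w ∈ R.weylGroup)
    (h : BruhatChain R u w) : BruhatChain R (R.wordProd l * u) (R.dmulList l w) := by
  induction l with
  | nil => exact h
  | cons i l ih =>
    rw [wordProd_cons, mul_assoc]
    exact hR.chain_S_mul_dmulStep i (dmulList_mem l hw) ih

lemma dmulStep_wordProd_of_reduced (hR : R.IsRootSystem) {i : Fin R.r} {l : List (Fin R.r)}
    (hl : R.Reduced (i :: l)) : R.dmulStep i (R.wordProd l) = R.wordProd (i :: l) := by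
  rw [wordProd_cons, dmulStep, if_pos]
  exact (hR.len_lt_len_S_mul_iff (wordProd_mem l) i).2 (hR.inv_simple_mem_pos_of_reduced hl)

lemma chain_of_sublist (hR : R.IsRootSystem) {l l' : List (Fin R.r)} (hl : R.Reduced l)
    (h : l'.Sublist l) :
    BruhatChain R (R.wordProd l') (R.wordProd l) := by
  induction h with
  | slnil => exact .refl
  | cons i h ih =>
    rw [← hR.dmulStep_wordProd_of_reduced hl]
    exact (ih (hR.reduced_of_cons hl)).trans (hR.chain_dmulStep i (wordProd_mem _))
  | cons_cons i h ih =>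
    rw [← hR.dmulStep_wordProd_of_reduced hl, wordProd_cons]
    exact hR.chain_S_mul_dmulStep i (wordProd_mem _) (ih (hR.reduced_of_cons hl))

lemma chain_of_bruhatLE (hR : R.IsRootSystem) {u w : R.Aut} (h : R.BruhatLE u w) :
    BruhatChain R u w := by
  obtain ⟨l, hl, rfl, l', hsub, rfl⟩ := h
  exact hR.chain_of_sublist hl hsub

lemma exists_sublist_dmulList (hR : R.IsRootSystem) {l m : List (Fin R.r)} (hl : R.Reduced l) :
    ∃ m' : List (Fin R.r), m'.Sublist m ∧
      R.dmulList l (R.wordProd m) = R.wordProd l * R.wordProd m' := by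
  induction l with
  | nil => exact ⟨m, .refl m, rfl⟩
  | cons i l ih =>
    obtain ⟨m', hm', hprod⟩ := ih (hR.reduced_of_cons hl)
    have hβ := hR.inv_simple_mem_pos_of_reduced hl
    have hmem : R.wordProd l * R.wordProd m' ∈ R.weylGroup :=
      mul_mem (wordProd_mem l) (wordProd_mem m')
    change ∃ m'' : List (Fin R.r), m''.Sublist m ∧
      R.dmulStep i (R.dmulList l (R.wordProd m)) = _
    rw [hprod, dmulStep]
    split_ifs with h
    · exact ⟨m', hm', by rw [wordProd_cons, mul_assoc]⟩
    · rw [hR.len_lt_len_S_mul_iff hmem, mul_inv_rev, LinearEquiv.mul_apply] at h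
      obtain ⟨m'', hsub, -, hprod'⟩ := hR.exchange m' hβ h
      refine ⟨m'', hsub.trans hm', ?_⟩
      have hconj := hR.s_weyl (inv_mem (wordProd_mem l)) (hR.simple_mem i)
      rw [hprod', wordProd_cons, eq_mul_inv_of_mul_eq hconj, inv_inv]
      change _ = R.S i * R.wordProd l * ((R.wordProd l)⁻¹ * R.S i * R.wordProd l * R.wordProd m')
      rw [show R.S i * R.wordProd l * ((R.wordProd l)⁻¹ * R.S i * R.wordProd l * R.wordProd m')
        = R.S i * R.S i * (R.wordProd l * R.wordProd m') by group, hR.S_mul_self, one_mul]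

lemma exists_reduced_dmul (hR : R.IsRootSystem) {v : R.Aut} (hv : v ∈ R.weylGroup) (w : R.Aut) :
    ∃ l : List (Fin R.r), R.Reduced l ∧ R.wordProd l = v ∧ R.dmul v w = R.dmulList l w := by
  have h := hR.exists_reduced hv
  exact ⟨h.choose, h.choose_spec.1, h.choose_spec.2, dif_pos h⟩

lemma chain_mul_dmul (hR : R.IsRootSystem) {u v w : R.Aut} (hv : v ∈ R.weylGroup)
    (hw : w ∈ R.weylGroup)
    (h : R.BruhatLE u w) : BruhatChain R (v * u) (R.dmul v w) := by
  obtain ⟨l, -, rfl, hl⟩ := hR.exists_reduced_dmul hv w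
  rw [hl]
  exact hR.chain_wordProd_mul_dmulList l hw (hR.chain_of_bruhatLE h)

lemma bruhatLE_mul_dmul_inv (hR : R.IsRootSystem) {v w : R.Aut} (hv : v ∈ R.weylGroup)
    (hw : w ∈ R.weylGroup) :
    R.BruhatLE (v * R.dmul v⁻¹ w) w := by
  obtain ⟨l, hl, hlv, hd⟩ := hR.exists_reduced_dmul (inv_mem hv) w
  obtain ⟨m, hm, rfl⟩ := hR.exists_reduced hw
  obtain ⟨m', hsub, h⟩ := hR.exists_sublist_dmulList (m := m) hl
  exact ⟨m, hm, rfl, m', hsub, by rw [hd, h, hlv, mul_inv_cancel_left]⟩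

lemma bruhatLE_mem {u w : R.Aut} (h : R.BruhatLE u w) : u ∈ R.weylGroup := by
  obtain ⟨_, _, _, l, _, rfl⟩ := h
  exact wordProd_mem l

lemma finite_bruhatLE (w : R.Aut) : {u : R.Aut | R.BruhatLE u w}.Finite := by
  refine Set.Finite.subset ((List.finite_length_le (Fin R.r) (R.len w)).image R.wordProd) ?_
  rintro u ⟨l, hl, rfl, l', hsub, rfl⟩
  exact ⟨l', hl ▸ hsub.length_le, rfl⟩

end Bruhat

section Dominance

lemma form_dominant_nonneg (hR : R.IsRootSystem) {lam : R.V} (hdom : R.Dominant lam) {β : R.V}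
    (hβ : β ∈ R.pos) :
    0 ≤ hR.form lam β := by
  obtain ⟨c, hc, rfl⟩ := hR.pos_nonneg_comb β hβ
  rw [form_sum_right]
  refine Finset.sum_nonneg fun i _ => ?_
  rw [form_smul_right]
  refine mul_nonneg (hc i) ?_
  have h1 := hdom i
  have h2 := hR.form_self_pos (hR.simple_mem i)
  rw [hR.coroot_eq (hR.simple_mem i), le_div_iff₀ h2] at h1
  linarith

lemma sub_mem_cone_of_chain (hR : R.IsRootSystem) {lam : R.V} (hdom : R.Dominant lam) {a b : R.Aut}
    (h : BruhatChain R a b) :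
    ∃ c : Fin R.r → ℚ, (∀ i, 0 ≤ c i) ∧ a lam - b lam = ∑ i, c i • R.α i := by
  induction h using Relation.ReflTransGen.head_induction_on with
  | refl => exact ⟨0, by simp, by simp⟩
  | @head a _ hstep _ ih =>
    obtain ⟨ha, β, hβ, haβ, rfl⟩ := hstep
    obtain ⟨c, hc, hsum⟩ := ih
    obtain ⟨d, hd, hβd⟩ := hR.pos_nonneg_comb β hβ
    have hq : 0 ≤ R.coroot β (a lam) := by
      have h1 := hR.form_weyl (inv_mem ha) (a lam) β
      have h2 := hR.form_dominant_nonneg hdom haβ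
      have h3 : a⁻¹ (a lam) = lam := a.symm_apply_apply lam
      rw [h3] at h1
      rw [hR.coroot_eq (hR.pos_subset hβ)]
      exact div_nonneg (by linarith) (hR.form_self_pos (hR.pos_subset hβ)).le
    refine ⟨fun i => R.coroot β (a lam) * d i + c i,
      fun i => add_nonneg (mul_nonneg hq (hd i)) (hc i), ?_⟩
    simp only [add_smul, Finset.sum_add_distrib, mul_smul]
    rw [← Finset.smul_sum, ← hβd, ← hsum, LinearEquiv.mul_apply, hR.s_apply (hR.pos_subset hβ)]
    abel

/-- Every functional on the ambient space is Weyl-conjugate to a dominant one. -/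
lemma exists_weyl_dominant_dual (hR : R.IsRootSystem) (f : Module.Dual ℚ R.V) :
    ∃ v ∈ R.weylGroup, ∀ i, 0 ≤ f (v (R.α i)) := by
  have hfin : ∀ v : R.Aut, {β ∈ R.pos | f (v β) < 0}.Finite := fun v =>
    hR.finite.subset fun β hβ => hR.pos_subset hβ.1
  obtain ⟨v, hv, hmin⟩ := exists_minimalFor_of_wellFoundedLT (fun v : R.Aut => v ∈ R.weylGroup)
    (fun v => {β ∈ R.pos | f (v β) < 0}.ncard) ⟨1, one_mem _⟩
  refine ⟨v, hv, fun i => ?_⟩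
  by_contra! hneg
  have hlt : {β ∈ R.pos | f ((v * R.S i) β) < 0}.ncard < {β ∈ R.pos | f (v β) < 0}.ncard := by
    rw [← Set.ncard_image_of_injective _ (R.S i).injective]
    refine Set.ncard_lt_ncard ⟨?_, ?_⟩ (hfin v)
    · rintro _ ⟨β, ⟨hβ, hfβ⟩, rfl⟩
      refine ⟨?_, hfβ⟩
      by_contra hn
      obtain ⟨c, hc, rfl⟩ := hR.eq_smul_of_S_notMem_pos hβ hn
      rw [LinearEquiv.mul_apply, map_smul, hR.S_simple, map_smul, map_neg, map_smul, map_neg,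
        smul_eq_mul] at hfβ
      nlinarith
    · intro hsub
      obtain ⟨β, ⟨hβ, -⟩, hβi⟩ := hsub ⟨hR.simple_pos i, hneg⟩
      have h1 : β = -R.α i := by rw [← hR.S_simple, ← hβi, hR.S_S]
      exact hR.neg_notMem_pos (hR.simple_pos i) (h1 ▸ hβ)
  exact absurd (hmin (mul_mem hv (S_mem_weylGroup i)) hlt.le) (not_le.2 hlt)

lemma dual_eq_sum (hR : R.IsRootSystem) {x : Fin R.r → Module.Dual ℚ R.V}
    (hx : ∀ i j : Fin R.r, x j (R.α i) = if i = j then 1 else 0) (f : Module.Dual ℚ R.V) :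
    f = ∑ i, f (R.α i) • x i := by
  refine LinearMap.ext_on_range hR.span_simple fun j => ?_
  simp [LinearMap.sum_apply, hx]

end Dominance

end RootData.IsRootSystem

theorem statement11 (R : RootData) (hR : R.IsRootSystem)
    (x : Fin R.r → Module.Dual ℚ R.V)
    (hx : ∀ i j : Fin R.r, x j (R.α i) = if i = j then 1 else 0)
    (lam : R.V) (hdom : R.Dominant lam)
    (w : R.Aut) (hw : w ∈ R.weylGroup) :
    (R.demPolytope lam w =
      ⋂ v ∈ (R.weylGroup : Set R.Aut),
        {nu : R.V | ∀ i : Fin R.r,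
          R.dualAct v (x i) ((v * R.dmul v⁻¹ w) lam) ≤ R.dualAct v (x i) nu}) ∧
      ∀ v₁ v₂ : R.Aut, v₁ ∈ R.weylGroup → v₂ ∈ R.weylGroup →
        ∃ c : Fin R.r → ℚ, (∀ i, 0 ≤ c i) ∧
          v₁⁻¹ ((v₂ * R.dmul v₂⁻¹ w) lam) - v₁⁻¹ ((v₁ * R.dmul v₁⁻¹ w) lam) =
            ∑ i, c i • R.α i := by
  have hcone : ∀ u v : R.Aut, R.BruhatLE u w → v ∈ R.weylGroup →
      ∃ c : Fin R.r → ℚ, (∀ i, 0 ≤ c i) ∧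
        v⁻¹ (u lam) - v⁻¹ ((v * R.dmul v⁻¹ w) lam) = ∑ i, c i • R.α i := by
    intro u v hu hv
    obtain ⟨c, hc, h⟩ := hR.sub_mem_cone_of_chain hdom (hR.chain_mul_dmul (inv_mem hv) hw hu)
    refine ⟨c, hc, ?_⟩
    rw [← h, ← LinearEquiv.mul_apply, ← LinearEquiv.mul_apply, inv_mul_cancel_left]
  refine ⟨Set.Subset.antisymm ?_ ?_, fun v₁ v₂ hv₁ hv₂ =>
    hcone _ v₁ (hR.bruhatLE_mul_dmul_inv hv₂ hw) hv₁⟩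
  · refine Set.subset_iInter₂ fun v hv => convexHull_min ?_ ?_
    · rintro _ ⟨u, -, hu, rfl⟩ i
      obtain ⟨c, hc, h⟩ := hcone u v hu hv
      have h1 := congrArg (x i) h
      simp only [map_sub, map_sum, map_smul, hx, smul_eq_mul, mul_ite, mul_one, mul_zero,
        Finset.sum_ite_eq', Finset.mem_univ, if_true] at h1
      change x i (v⁻¹ _) ≤ x i (v⁻¹ _)
      linarith [hc i]
    · simp only [Set.ofPred_forall]
      exact convex_iInter fun i => convex_halfSpace_ge (R.dualAct v (x i)).isLinear _
  · intro nu hnu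
    by_contra hn
    have hfin : {m | ∃ u : R.Aut, u ∈ R.weylGroup ∧ R.BruhatLE u w ∧ m = u lam}.Finite := by
      refine ((RootData.IsRootSystem.finite_bruhatLE w).image fun u => u lam).subset ?_
      rintro _ ⟨u, -, hu, rfl⟩
      exact ⟨u, hu, rfl⟩
    obtain ⟨f, hf⟩ := exists_dual_lt_of_notMem_convexHull_s11 hfin hn
    obtain ⟨v, hv, hpos⟩ := hR.exists_weyl_dominant_dual f
    have hmu := hR.bruhatLE_mul_dmul_inv hv hw
    refine absurd (hf _ ⟨_, RootData.IsRootSystem.bruhatLE_mem hmu, hmu, rfl⟩) (not_lt.2 ?_)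
    have hfv : ∀ y, f y = ∑ i, f (v (R.α i)) * R.dualAct v (x i) y := by
      intro y
      have h := LinearMap.congr_fun
        (hR.dual_eq_sum hx (f ∘ₗ (v : R.V →ₗ[ℚ] R.V))) (v.symm y)
      simpa [LinearMap.sum_apply, RootData.dualAct] using h
    rw [hfv, hfv nu]
    exact Finset.sum_le_sum fun i _ =>
      mul_le_mul_of_nonneg_left (Set.mem_iInter₂.1 hnu v hv i) (hpos i)
end
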